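/- Let u = x_i x_j > v = x_r x_s (i < j, r < s) be squarefree monomials of degree 2 in k[x₁,…,xₙ], let Δ be the simplicial complex on [n] with I_Δ = (L(u,v)), let Δ₁ be the full simplex on {1,…,i−1}, let Δ₂ be the complex of the ideal generated by L(u,v) in k[x_i,…,xₙ], and let t ≥ 2. Assume Δ is not CM_{t−1} over k. Then Δ is CM_t over k if and only if Δ₁ has dimension t − 2 (i.e., i = t) and Δ₂ is pure. -/

import Mathlib

open Finset

/-- An abstract simplicial complex on the vertex type `V`: a collection of
finite subsets of `V` (the faces) closed under passing to subsets. -/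
structure SComplex (V : Type*) where
  faces : Set (Finset V)
  down_closed : ∀ ⦃F G : Finset V⦄, F ∈ faces → G ⊆ F → G ∈ faces

namespace SComplex

variable {V : Type*} [DecidableEq V]

/-- The vertex set of a simplicial complex. -/
def vertexSet (Δ : SComplex V) : Set V := {v | {v} ∈ Δ.faces}

/-- A facet is a maximal face. -/
def IsFacet (Δ : SComplex V) (F : Finset V) : Prop :=
  F ∈ Δ.faces ∧ ∀ G ∈ Δ.faces, F ⊆ G → F = G

/-- A complex is pure if all of its facets have the same dimension (cardinality). -/
def Pure (Δ : SComplex V) : Prop :=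
  ∀ ⦃F G⦄, Δ.IsFacet F → Δ.IsFacet G → F.card = G.card

/-- One more than the dimension: the largest cardinality of a face of `Δ`.
So `Δ.dimSucc = d` means `Δ` has dimension `d - 1`. -/
noncomputable def dimSucc (Δ : SComplex V) : ℕ :=
  sSup {n | ∃ F ∈ Δ.faces, F.card = n}

/-- The link of a face `F` : `link Δ F = {G ∈ Δ : G ∪ F ∈ Δ, G ∩ F = ∅}`. -/
def link (Δ : SComplex V) (F : Finset V) : SComplex V where
  faces := {G | G ∈ Δ.faces ∧ Disjoint G F ∧ G ∪ F ∈ Δ.faces}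
  down_closed := by
    rintro G H ⟨hG, hdis, hGF⟩ hHG
    exact ⟨Δ.down_closed hG hHG, Finset.disjoint_of_subset_left hHG hdis,
      Δ.down_closed hGF (Finset.union_subset_union_left hHG)⟩

/-- A complex is connected if it has a vertex and any two vertices are joined
by a path of edges (connectivity of the 1-skeleton). -/
def Connected (Δ : SComplex V) : Prop :=
  (∃ v, {v} ∈ Δ.faces) ∧
    ∀ a b : V, {a} ∈ Δ.faces → {b} ∈ Δ.faces →
      Relation.ReflTransGen (fun x y => x ≠ y ∧ ({x, y} : Finset V) ∈ Δ.faces) a b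

/-- The join of two simplicial complexes (on disjoint vertex sets):
`Δ₁ ∗ Δ₂ = {F ∪ G : F ∈ Δ₁, G ∈ Δ₂}`. -/
def join (Δ₁ Δ₂ : SComplex V) : SComplex V where
  faces := {H | ∃ F ∈ Δ₁.faces, ∃ G ∈ Δ₂.faces, H = F ∪ G}
  down_closed := by
    rintro H H' ⟨F, hF, G, hG, rfl⟩ hsub
    refine ⟨H' ∩ F, Δ₁.down_closed hF inter_subset_right,
      H' \ F, Δ₂.down_closed hG ?_, ?_⟩
    · intro x hx
      rcases Finset.mem_sdiff.mp hx with ⟨hx1, hx2⟩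
      rcases Finset.mem_union.mp (hsub hx1) with h | h
      · exact absurd h hx2
      · exact h
    · ext x
      by_cases hx : x ∈ F <;>
        simp only [Finset.mem_union, Finset.mem_inter, Finset.mem_sdiff, hx] <;> tauto

/-- The full simplex on a finite vertex set `W`. -/
def simplexOn (W : Finset V) : SComplex V :=
  ⟨{F | F ⊆ W}, fun _ _ hF hG => hG.trans hF⟩

/-- A shelling of `Δ`: an ordering `l` of all the facets of `Δ` such that each
facet meets the union of the previous ones in a nonempty union of
codimension-one faces of it. -/
def IsShelling (Δ : SComplex V) (l : List (Finset V)) : Prop :=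
  l.Nodup ∧ (∀ F, F ∈ l ↔ Δ.IsFacet F) ∧
    ∀ i j : ℕ, j < i → i < l.length →
      ∃ m, m < i ∧ ∃ v ∈ l[i]!,
        l[i]! ∩ l[j]! ⊆ l[i]! ∩ l[m]! ∧ l[i]! ∩ l[m]! = l[i]!.erase v

/-- A complex is shellable if its facets admit a shelling order. -/
def Shellable (Δ : SComplex V) : Prop := ∃ l, IsShelling Δ l

/-- The reduced homology `H̃₀(Δ; k)` vanishes: every `k`-linear combination of
vertices of `Δ` with coefficient sum zero is a `k`-linear combination of
boundaries of edges of `Δ`. -/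
def ReducedH0Vanishes (k : Type*) [Field k] (Δ : SComplex V) : Prop :=
  ∀ f : V →₀ k, (∀ v ∈ f.support, {v} ∈ Δ.faces) → (f.sum fun _ c => c) = 0 →
    f ∈ Submodule.span k {g : V →₀ k | ∃ a b : V, a ≠ b ∧ ({a, b} : Finset V) ∈ Δ.faces ∧
      g = Finsupp.single a 1 - Finsupp.single b 1}

end SComplex

/-- A commutative ring satisfies Serre's condition `S₂` if for every prime `p`
the localization at `p` contains, inside its maximal ideal, a regular sequence
of length at least `min 2 (dim R_p)`. -/
def RingSerreS2 (R : Type*) [CommRing R] : Prop :=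
  ∀ (p : Ideal R) [p.IsPrime],
    ∃ rs : List (Localization.AtPrime p),
      (∀ r ∈ rs, r ∈ IsLocalRing.maximalIdeal (Localization.AtPrime p)) ∧
      RingTheory.Sequence.IsRegular (Localization.AtPrime p) rs ∧
      min 2 (ringKrullDim (Localization.AtPrime p)) ≤ (rs.length : WithBot ℕ∞)

section GroundSet

/-- The squarefree monomial `∏_{i ∈ S} xᵢ` in the polynomial ring whose
variables are indexed by the ground set `W ⊆ ℕ`. -/
noncomputable def monoW (k : Type*) [CommRing k] (W S : Finset ℕ) :
    MvPolynomial {x // x ∈ W} k :=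
  ∏ i ∈ S.subtype (· ∈ W), MvPolynomial.X i

/-- The Stanley–Reisner ideal of a complex `Δ` with ground (vertex) set `W ⊆ ℕ`,
inside the polynomial ring `k[xᵢ : i ∈ W]`: it is generated by the squarefree
monomials of the non-faces contained in `W`. -/
noncomputable def srIdealW (k : Type*) [CommRing k] (W : Finset ℕ) (Δ : SComplex ℕ) :
    Ideal (MvPolynomial {x // x ∈ W} k) :=
  Ideal.span {p | ∃ F : Finset ℕ, F ⊆ W ∧ F ∉ Δ.faces ∧ p = monoW k W F}

/-- The Stanley–Reisner ring `k[Δ]` of a complex with ground set `W ⊆ ℕ`. -/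
abbrev srRingW (k : Type*) [CommRing k] (W : Finset ℕ) (Δ : SComplex ℕ) :=
  MvPolynomial {x // x ∈ W} k ⧸ srIdealW k W Δ

/-- The irrelevant maximal ideal of the Stanley–Reisner ring. -/
noncomputable def srIrrelevantW (k : Type*) [CommRing k] (W : Finset ℕ)
    (Δ : SComplex ℕ) : Ideal (srRingW k W Δ) :=
  (Ideal.span (Set.range (MvPolynomial.X : {x // x ∈ W} → MvPolynomial {x // x ∈ W} k))).map
    (Ideal.Quotient.mk (srIdealW k W Δ))

/-- `Δ` (a complex with ground set `W ⊆ ℕ`) is Cohen–Macaulay over the field `k`: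
the ring `k[Δ]` admits a regular sequence, inside the irrelevant maximal ideal,
whose length equals the Krull dimension of `k[Δ]`. -/
def IsCMW (k : Type*) [Field k] (W : Finset ℕ) (Δ : SComplex ℕ) : Prop :=
  ∃ rs : List (srRingW k W Δ), (∀ r ∈ rs, r ∈ srIrrelevantW k W Δ) ∧
    RingTheory.Sequence.IsRegular (srRingW k W Δ) rs ∧
    ringKrullDim (srRingW k W Δ) = (rs.length : WithBot ℕ∞)

/-- `Δ` is `CM_t` (Cohen–Macaulay in codimension `t`) over `k`: `Δ` is pure and
`link_Δ(F)` is Cohen–Macaulay over `k` for every face `F` with `#F ≥ t`.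
`CM_1` is the Buchsbaum property. -/
def IsCMtW (k : Type*) [Field k] (W : Finset ℕ) (t : ℕ) (Δ : SComplex ℕ) : Prop :=
  Δ.Pure ∧ ∀ F ∈ Δ.faces, t ≤ F.card → IsCMW k W (Δ.link F)

end GroundSet

section Lex

/-- Comparison of squarefree monomials of the same degree in the lexicographic
order with `x₁ > x₂ > ⋯ > xₙ`, the monomials being identified with their
supports: `u >_lex v` iff the smallest variable index where they differ
belongs to `u`. -/
def lexGT (A B : Finset ℕ) : Prop :=
  ∃ m ∈ A, m ∉ B ∧ ∀ x < m, (x ∈ A ↔ x ∈ B)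

/-- `u ≥_lex v` for squarefree monomials identified with their supports. -/
def lexGE (A B : Finset ℕ) : Prop := A = B ∨ lexGT A B

/-- The lexsegment `L(u,v)` of squarefree monomials of degree `d` in
`x₁, …, xₙ`, the monomials being identified with their supports:
all `S ⊆ [n] = {1, …, n}` with `#S = d` and `u ≥_lex S ≥_lex v`. -/
def lexSegment (n d : ℕ) (U V₀ : Finset ℕ) : Set (Finset ℕ) :=
  {S | S ⊆ Finset.Icc 1 n ∧ S.card = d ∧ lexGE U S ∧ lexGE S V₀}

/-- The ideal of `k[xᵢ : i ∈ W]` generated by the squarefree monomials of the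
lexsegment `L(u,v)` (of degree-`d` squarefree monomials in `x₁, …, xₙ`). -/
noncomputable def lexIdealW (k : Type*) [CommRing k] (W : Finset ℕ) (n d : ℕ)
    (U V₀ : Finset ℕ) : Ideal (MvPolynomial {x // x ∈ W} k) :=
  Ideal.span {p | ∃ S ∈ lexSegment n d U V₀, p = monoW k W S}

end Lex


/-- `rs` is a weakly regular sequence modulo the ideal `I`. -/
def RegularMod {S : Type*} [CommRing S] : List S → Ideal S → Prop
  | [], _ => True
  | r :: rs, I => (∀ a, r * a ∈ I → a ∈ I) ∧ RegularMod rs (I ⊔ Ideal.span {r})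

namespace RegularMod

variable {S : Type*} [CommRing S]

theorem iff_isWeaklyRegular (rs : List S) (I : Ideal S) :
    RegularMod rs I ↔ RingTheory.Sequence.IsWeaklyRegular (S ⧸ I) rs := by
  induction rs generalizing I with
  | nil => simp [RegularMod]
  | cons r rs ih =>
    rw [RingTheory.Sequence.isWeaklyRegular_cons_iff, RegularMod, ih]
    refine and_congr ?_ ?_
    · rw [isSMulRegular_iff_right_eq_zero_of_smul]
      constructor
      · intro h m
        obtain ⟨a, rfl⟩ := Ideal.Quotient.mk_surjective m
        intro ha
        rw [Ideal.Quotient.eq_zero_iff_mem]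
        refine h a ?_
        rw [← Ideal.Quotient.eq_zero_iff_mem, map_mul]
        simpa [Algebra.smul_def] using ha
      · intro h a ha
        rw [← Ideal.Quotient.eq_zero_iff_mem] at ha ⊢
        refine h _ ?_
        simpa [Algebra.smul_def] using ha
    · refine (LinearEquiv.isWeaklyRegular_congr
        ((Submodule.quotEquivOfEq _ _ ?_).trans
          (Submodule.quotientQuotientEquivQuotientSup I (Ideal.span {r}))) rs).symm
      ext x
      constructor
      · intro hx
        obtain ⟨y, -, rfl⟩ := (Submodule.mem_smul_pointwise_iff_exists x r ⊤).1 hx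
        obtain ⟨a, rfl⟩ := Submodule.mkQ_surjective _ y
        exact ⟨r * a, Ideal.mul_mem_right _ _ (Ideal.mem_span_singleton_self r), rfl⟩
      · rintro ⟨a, ha, rfl⟩
        obtain ⟨b, rfl⟩ := Ideal.mem_span_singleton'.1 ha
        refine (Submodule.mem_smul_pointwise_iff_exists _ r ⊤).2 ⟨I.mkQ b, trivial, ?_⟩
        rw [mul_comm, ← smul_eq_mul, map_smul]

theorem iff_isWeaklyRegular_map_mk (rs : List S) (I : Ideal S) :
    RegularMod rs I ↔
      RingTheory.Sequence.IsWeaklyRegular (S ⧸ I) (rs.map (Ideal.Quotient.mk I)) :=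
  (iff_isWeaklyRegular rs I).trans
    (RingTheory.Sequence.isWeaklyRegular_map_algebraMap_iff (S ⧸ I) (S ⧸ I) rs).symm

/-- Weak regularity modulo `I + (x)` and modulo `I : x` implies weak regularity modulo `I`. -/
theorem of_sup_span_of_colon (x : S) (rs : List S) {I J : Ideal S}
    (hJ : ∀ a, x * a ∈ I ↔ a ∈ J) (h₁ : RegularMod rs (I ⊔ Ideal.span {x}))
    (h₂ : RegularMod rs J) : RegularMod rs I := by
  induction rs generalizing I J with
  | nil => trivial
  | cons r rs ih =>
    obtain ⟨h₁r, h₁⟩ := h₁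
    obtain ⟨h₂r, h₂⟩ := h₂
    refine ⟨fun a ha => ?_, ih (J := J ⊔ Ideal.span {r}) (fun a => ⟨fun ha => ?_, fun ha => ?_⟩)
      ?_ h₂⟩
    · have h := h₁r a (Ideal.mem_sup_left ha)
      obtain ⟨p, hp, q, hq, rfl⟩ := Submodule.mem_sup.1 h
      obtain ⟨c, rfl⟩ := Ideal.mem_span_singleton'.1 hq
      refine add_mem hp ?_
      have h' : x * (r * c) ∈ I := by
        have : x * (r * c) = r * (p + c * x) - r * p := by ring
        rw [this]
        exact sub_mem ha (I.mul_mem_left _ hp)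
      rw [mul_comm]
      exact (hJ c).2 (h₂r c ((hJ _).1 h'))
    · obtain ⟨p, hp, q, hq, hpq⟩ := Submodule.mem_sup.1 ha
      obtain ⟨b, rfl⟩ := Ideal.mem_span_singleton'.1 hq
      have hb : b ∈ I ⊔ Ideal.span {x} := by
        refine h₁r b ?_
        have : r * b = x * a - p := by rw [← hpq]; ring
        rw [this]
        exact sub_mem (Ideal.mem_sup_right (Ideal.mul_mem_right _ _
          (Ideal.mem_span_singleton_self x))) (Ideal.mem_sup_left hp)
      obtain ⟨p', hp', q', hq', rfl⟩ := Submodule.mem_sup.1 hb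
      obtain ⟨c, rfl⟩ := Ideal.mem_span_singleton'.1 hq'
      have h' : x * (a - r * c) ∈ I := by
        have : x * (a - r * c) = p + p' * r := by
          rw [mul_sub, ← hpq]; ring
        rw [this]
        exact add_mem hp (I.mul_mem_right _ hp')
      have : a = (a - r * c) + c * r := by ring
      rw [this]
      exact add_mem (Ideal.mem_sup_left ((hJ _).1 h'))
        (Ideal.mem_sup_right (Ideal.mul_mem_left _ _ (Ideal.mem_span_singleton_self r)))
    · obtain ⟨p, hp, q, hq, rfl⟩ := Submodule.mem_sup.1 ha
      rw [mul_add]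
      exact add_mem (Ideal.mem_sup_left ((hJ p).2 hp))
        (Ideal.mem_sup_right (Ideal.mul_mem_left _ _ hq))
    · rwa [sup_right_comm]

end RegularMod

section KrullDim

variable {σ k : Type*} [Finite σ] [Field k]

open MvPolynomial

theorem ringKrullDim_mvPolynomial_field (τ : Type*) [Finite τ] (k : Type*) [Field k] :
    ringKrullDim (MvPolynomial τ k) = Nat.card τ := by
  rw [MvPolynomial.ringKrullDim_of_isNoetherianRing, ringKrullDim_eq_zero_of_field, zero_add]

theorem ringKrullDim_quotient_span_X_le (U : Set σ) :
    ringKrullDim (MvPolynomial σ k ⧸ Ideal.span (X '' U : Set (MvPolynomial σ k))) ≤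
      Nat.card ↥(Uᶜ) := by
  rw [← ringKrullDim_mvPolynomial_field _ k]
  let I := Ideal.span (X '' U : Set (MvPolynomial σ k))
  refine ringKrullDim_le_of_surjective
    (aeval (fun w : ↥(Uᶜ) => Ideal.Quotient.mk I (X w.1))).toRingHom ?_
  intro y
  obtain ⟨p, rfl⟩ := Ideal.Quotient.mk_surjective y
  change Ideal.Quotient.mk I p ∈ (aeval (fun w : ↥(Uᶜ) => Ideal.Quotient.mk I (X w.1))).range
  induction p using MvPolynomial.induction_on with
  | C a => exact ⟨C a, by simp; rfl⟩
  | add p q hp hq => rw [map_add]; exact add_mem hp hq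
  | mul_X p w hp =>
    rw [map_mul]
    refine mul_mem hp ?_
    by_cases hw : w ∈ U
    · have : Ideal.Quotient.mk I (X w) = 0 :=
        Ideal.Quotient.eq_zero_iff_mem.2 (Ideal.subset_span ⟨w, hw, rfl⟩)
      rw [this]
      exact zero_mem _
    · exact ⟨X ⟨w, hw⟩, by simp⟩

/-- If every prime over `I` misses at most `m` variables then `k[x]/I` has dimension at most `m`. -/
theorem ringKrullDim_quotient_le_of_card (I : Ideal (MvPolynomial σ k)) (m : ℕ)
    (h : ∀ p : Ideal (MvPolynomial σ k), p.IsPrime → I ≤ p →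
      Nat.card ↥({w : σ | X w ∈ p}ᶜ) ≤ m) :
    ringKrullDim (MvPolynomial σ k ⧸ I) ≤ m := by
  rw [ringKrullDim_quotient]
  refine iSup_le fun l => ?_
  let p := l.head.1.asIdeal
  let U := {w : σ | X w ∈ p}
  have hp : I ≤ p := l.head.2
  have hle (i : Fin (l.length + 1)) :
      (l i).1 ∈ PrimeSpectrum.zeroLocus
        (Ideal.span (X '' U : Set (MvPolynomial σ k)) : Set (MvPolynomial σ k)) := by
    have h0 : l.head ≤ l i := LTSeries.head_le l i
    change _ ≤ (l i).1.asIdeal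
    refine le_trans (Ideal.span_le.2 ?_) (show p ≤ (l i).1.asIdeal from h0)
    rintro _ ⟨w, hw, rfl⟩
    exact hw
  let l' : LTSeries (PrimeSpectrum.zeroLocus
      (Ideal.span (X '' U : Set (MvPolynomial σ k)) : Set (MvPolynomial σ k))) :=
    { length := l.length
      toFun := fun i => ⟨(l i).1, hle i⟩
      step := fun i => l.step i }
  have h1 : (l.length : WithBot ℕ∞) ≤ _ := Order.LTSeries.length_le_krullDim l'
  rw [← ringKrullDim_quotient] at h1
  refine h1.trans ((ringKrullDim_quotient_span_X_le U).trans ?_)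
  exact_mod_cast h p l.head.1.2 hp

end KrullDim

section ColorIdeal

open MvPolynomial

variable {σ C : Type*} (k : Type*) [Field k] (f : σ → C)

/-- The ideal generated by the variables in `U` and by the products of two distinct variables
of the same color. -/
noncomputable def colorIdeal (U : Set σ) : Ideal (MvPolynomial σ k) :=
  Ideal.span ((fun e => monomial e (1 : k)) ''
    ({e | ∃ w ∈ U, e = Finsupp.single w 1} ∪
      {e | ∃ a b, a ≠ b ∧ f a = f b ∧ e = Finsupp.single a 1 + Finsupp.single b 1}))

variable {k f}

theorem single_add_single_le_iff {a b : σ} (hab : a ≠ b) (m : σ →₀ ℕ) :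
    Finsupp.single a 1 + Finsupp.single b 1 ≤ m ↔ m a ≠ 0 ∧ m b ≠ 0 := by
  classical
  constructor
  · intro h
    have ha := h a
    have hb := h b
    simp [hab, hab.symm] at ha hb
    lia
  · rintro ⟨ha, hb⟩ w
    simp only [Finsupp.add_apply, Finsupp.single_apply]
    split_ifs with h₁ h₂ h₂
    · exact absurd (h₁.trans h₂.symm) hab
    · subst h₁; lia
    · subst h₂; lia
    · lia

theorem mem_colorIdeal {U : Set σ} {p : MvPolynomial σ k} :
    p ∈ colorIdeal k f U ↔ ∀ m ∈ p.support, (∃ w ∈ U, m w ≠ 0) ∨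
      ∃ a b, a ≠ b ∧ f a = f b ∧ m a ≠ 0 ∧ m b ≠ 0 := by
  rw [colorIdeal, mem_ideal_span_monomial_image]
  refine forall₂_congr fun m _ => ?_
  constructor
  · rintro ⟨e, ⟨w, hw, rfl⟩ | ⟨a, b, hab, hf, rfl⟩, he⟩
    · exact Or.inl ⟨w, hw, by simpa [Nat.one_le_iff_ne_zero] using he⟩
    · exact Or.inr ⟨a, b, hab, hf, (single_add_single_le_iff hab m).1 he⟩
  · rintro (⟨w, hw, hm⟩ | ⟨a, b, hab, hf, hm⟩)
    · exact ⟨_, Or.inl ⟨w, hw, rfl⟩, by simpa [Nat.one_le_iff_ne_zero] using hm⟩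
    · exact ⟨_, Or.inr ⟨a, b, hab, hf, rfl⟩, (single_add_single_le_iff hab m).2 hm⟩

theorem colorIdeal_mono {U U' : Set σ} (h : U ⊆ U') : colorIdeal k f U ≤ colorIdeal k f U' := by
  intro p hp
  rw [mem_colorIdeal] at hp ⊢
  exact fun m hm => (hp m hm).imp_left fun ⟨w, hw, h'⟩ => ⟨w, h hw, h'⟩

theorem X_mem_colorIdeal {U : Set σ} {w : σ} (hw : w ∈ U) :
    (X w : MvPolynomial σ k) ∈ colorIdeal k f U :=
  Ideal.subset_span ⟨_, Or.inl ⟨w, hw, rfl⟩, rfl⟩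

theorem X_mul_X_mem_colorIdeal (U : Set σ) {a b : σ} (hab : a ≠ b) (hf : f a = f b) :
    (X a * X b : MvPolynomial σ k) ∈ colorIdeal k f U := by
  have h : (X a * X b : MvPolynomial σ k) =
      monomial (Finsupp.single a 1 + Finsupp.single b 1) 1 := by
    rw [X, X, monomial_mul, one_mul]
  rw [h]
  exact Ideal.subset_span ⟨_, Or.inr ⟨a, b, hab, hf, rfl⟩, rfl⟩

theorem colorIdeal_sup_span_X (U : Set σ) (x : σ) :
    colorIdeal k f U ⊔ Ideal.span {X x} = colorIdeal k f (insert x U) := by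
  apply le_antisymm
  · refine sup_le (colorIdeal_mono (Set.subset_insert x U)) ?_
    rw [Ideal.span_singleton_le_iff_mem]
    exact X_mem_colorIdeal (Set.mem_insert x U)
  · refine Ideal.span_le.2 ?_
    rintro _ ⟨e, ⟨w, rfl | hw, rfl⟩ | ⟨a, b, hab, hf, rfl⟩, rfl⟩
    · exact Ideal.mem_sup_right (Ideal.mem_span_singleton_self _)
    · exact Ideal.mem_sup_left (X_mem_colorIdeal hw)
    · have h : monomial (Finsupp.single a 1 + Finsupp.single b 1) (1 : k) ∈ colorIdeal k f U :=
        Ideal.subset_span ⟨_, Or.inr ⟨a, b, hab, hf, rfl⟩, rfl⟩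
      exact Ideal.mem_sup_left h

theorem X_mul_mem_colorIdeal_iff {U : Set σ} {x : σ} (hx : x ∉ U) (p : MvPolynomial σ k) :
    X x * p ∈ colorIdeal k f U ↔ p ∈ colorIdeal k f (U ∪ {y | y ≠ x ∧ f y = f x}) := by
  classical
  rw [mem_colorIdeal, mem_colorIdeal, support_X_mul]
  simp only [Finset.mem_map, addLeftEmbedding_apply, forall_exists_index, and_imp,
    forall_apply_eq_imp_iff₂, Finsupp.add_apply, Finsupp.single_apply]
  refine forall₂_congr fun m _ => ?_
  constructor
  · rintro (⟨w, hw, hm⟩ | ⟨a, b, hab, hf, ha, hb⟩)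
    · have : x ≠ w := by rintro rfl; exact hx hw
      exact Or.inl ⟨w, Or.inl hw, by simpa [this] using hm⟩
    · by_cases hxa : x = a
      · subst hxa
        exact Or.inl ⟨b, Or.inr ⟨hab.symm, hf.symm⟩, by simpa [hab] using hb⟩
      · by_cases hxb : x = b
        · subst hxb
          exact Or.inl ⟨a, Or.inr ⟨hab, hf⟩, by simpa [hxa] using ha⟩
        · exact Or.inr ⟨a, b, hab, hf, by simpa [hxa] using ha, by simpa [hxb] using hb⟩
  · rintro (⟨w, hw | ⟨hwx, hf⟩, hm⟩ | ⟨a, b, hab, hf, ha, hb⟩)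
    · exact Or.inl ⟨w, hw, by lia⟩
    · exact Or.inr ⟨w, x, hwx, hf, by lia, by simp⟩
    · exact Or.inr ⟨a, b, hab, hf, by lia, by lia⟩

variable [Fintype σ] [DecidableEq C]

variable (k f) in
/-- The sum of the variables of color `c`. -/
noncomputable def colorSum (c : C) : MvPolynomial σ k :=
  ∑ w with f w = c, X w

theorem colorSum_sub_X_mem {U : Set σ} (hU : ∀ a ∉ U, ∀ b ∉ U, f a = f b → a = b) {b : σ}
    (hb : b ∉ U) : colorSum k f (f b) - X b ∈ colorIdeal k f U := by
  classical
  rw [colorSum, ← Finset.add_sum_erase _ _ (show b ∈ _ by simp), add_sub_cancel_left]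
  refine Ideal.sum_mem _ fun w hw => X_mem_colorIdeal ?_
  simp only [Finset.mem_erase, Finset.mem_filter, Finset.mem_univ, true_and] at hw
  by_contra h
  exact hw.1 (hU w h b hb hw.2)

theorem regularMod_colorIdeal_of_injOn (l : List C) (hl : l.Nodup) (U : Set σ)
    (hU : ∀ a ∉ U, ∀ b ∉ U, f a = f b → a = b) (hlU : ∀ c ∈ l, ∃ w ∉ U, f w = c) :
    RegularMod (l.map (colorSum k f)) (colorIdeal k f U) := by
  induction l generalizing U with
  | nil => trivial
  | cons c l ih =>
    obtain ⟨b, hb, rfl⟩ := hlU c (by simp)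
    have hsub := colorSum_sub_X_mem (k := k) hU hb
    refine ⟨fun a ha => ?_, ?_⟩
    · have h : X b * a ∈ colorIdeal k f U := by
        have : X b * a = colorSum k f (f b) * a - (colorSum k f (f b) - X b) * a := by ring
        rw [this]
        exact sub_mem ha (Ideal.mul_mem_right _ _ hsub)
      rw [X_mul_mem_colorIdeal_iff hb] at h
      refine colorIdeal_mono (Set.union_subset le_rfl ?_) h
      rintro y ⟨hyb, hy⟩
      by_contra hyU
      exact hyb (hU y hyU b hb hy)
    · have h : colorIdeal k f U ⊔ Ideal.span {colorSum k f (f b)} =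
          colorIdeal k f (insert b U) := by
        rw [← colorIdeal_sup_span_X]
        apply le_antisymm <;> refine sup_le le_sup_left ?_ <;>
          rw [Ideal.span_singleton_le_iff_mem]
        · rw [← sub_add_cancel (colorSum k f (f b)) (X b)]
          exact add_mem (Ideal.mem_sup_left hsub)
            (Ideal.mem_sup_right (Ideal.mem_span_singleton_self _))
        · rw [← sub_sub_cancel (colorSum k f (f b)) (X b)]
          exact sub_mem (Ideal.mem_sup_right (Ideal.mem_span_singleton_self _))
            (Ideal.mem_sup_left hsub)
      change RegularMod (l.map (colorSum k f)) (colorIdeal k f U ⊔ Ideal.span {_})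
      rw [h]
      have hl' := List.nodup_cons.1 hl
      refine ih hl'.2 _ (fun a ha b' hb' => hU a (fun h => ha (Or.inr h)) b'
        (fun h => hb' (Or.inr h))) fun c hc => ?_
      obtain ⟨w, hw, rfl⟩ := hlU c (by simp [hc])
      refine ⟨w, ?_, rfl⟩
      rintro (rfl | h)
      · exact hl'.1 hc
      · exact hw h

theorem regularMod_colorIdeal (l : List C) (hl : l.Nodup) (U : Set σ)
    (hlU : ∀ c ∈ l, ∃ w ∉ U, f w = c) :
    RegularMod (l.map (colorSum k f)) (colorIdeal k f U) := by
  induction hN : (Uᶜ).ncard using Nat.strong_induction_on generalizing U with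
  | _ N ih =>
    by_cases hU : ∀ a ∉ U, ∀ b ∉ U, f a = f b → a = b
    · exact regularMod_colorIdeal_of_injOn l hl U hU hlU
    push Not at hU
    obtain ⟨x, hx, y, hy, hf, hxy⟩ := hU
    have hlt {V : Set σ} (hUV : U ⊆ V) {z : σ} (hzV : z ∈ V) (hzU : z ∉ U) :
        (Vᶜ).ncard < N := by
      rw [← hN]
      refine Set.ncard_lt_ncard ⟨Set.compl_subset_compl.2 hUV, fun h => ?_⟩
      exact h hzU hzV
    refine RegularMod.of_sup_span_of_colon (X x) _ (X_mul_mem_colorIdeal_iff hx) ?_ ?_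
    · rw [colorIdeal_sup_span_X]
      refine ih _ (hlt (Set.subset_insert x U) (Set.mem_insert x U) hx) _ (fun c hc => ?_) rfl
      obtain ⟨w, hw, rfl⟩ := hlU c hc
      by_cases hwx : w = x
      · subst hwx
        exact ⟨y, by rintro (h | h); exacts [hxy h.symm, hy h], hf.symm⟩
      · exact ⟨w, by rintro (h | h); exacts [hwx h, hw h], rfl⟩
    · refine ih _ (hlt Set.subset_union_left (show y ∈ U ∪ {y | y ≠ x ∧ f y = f x} from Or.inr ⟨hxy.symm, hf.symm⟩) hy) _
        (fun c hc => ?_) rfl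
      obtain ⟨w, hw, rfl⟩ := hlU c hc
      by_cases hwx : f w = f x
      · exact ⟨x, by rintro (h | h); exacts [hx h, h.1 rfl], hwx.symm⟩
      · exact ⟨w, by rintro (h | h); exacts [hw h, hwx h.2], rfl⟩

end ColorIdeal

section StanleyReisner

open MvPolynomial

variable {k : Type*} [Field k] {W : Finset ℕ}

theorem monoW_mem_span_iff (P : Finset ℕ → Prop) (F : Finset ℕ) :
    monoW k W F ∈ Ideal.span {p | ∃ S, P S ∧ p = monoW k W S} ↔
      ∃ S, P S ∧ ∀ x ∈ S, x ∈ W → x ∈ F := by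
  constructor
  · intro h
    by_contra! hF
    let φ : MvPolynomial {x // x ∈ W} k →ₐ[k] k := aeval fun w => if w.1 ∈ F then 1 else 0
    have hle : Ideal.span {p | ∃ S, P S ∧ p = monoW k W S} ≤ RingHom.ker φ := by
      refine Ideal.span_le.2 ?_
      rintro _ ⟨S, hS, rfl⟩
      obtain ⟨x, hxS, hxW, hxF⟩ := hF S hS
      change φ _ = 0
      rw [monoW, map_prod]
      exact Finset.prod_eq_zero (i := ⟨x, hxW⟩) (by simpa using hxS) (by simp [φ, hxF])
    have h1 : φ (monoW k W F) = 0 := hle h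
    have h2 : φ (monoW k W F) = 1 := by
      rw [monoW, map_prod]
      exact Finset.prod_eq_one fun w hw => by
        have : w.1 ∈ F := by simpa using hw
        simp [φ, this]
    exact one_ne_zero (h2.symm.trans h1)
  · rintro ⟨S, hS, hSF⟩
    have hsub : S.subtype (· ∈ W) ⊆ F.subtype (· ∈ W) := by
      intro w hw
      simp only [Finset.mem_subtype] at hw ⊢
      exact hSF _ hw w.2
    exact Ideal.mem_of_dvd _ (Finset.prod_dvd_prod_of_subset _ _ _ hsub)
      (Ideal.subset_span ⟨S, hS, rfl⟩)

theorem monoW_mem_srIdealW_iff (Γ : SComplex ℕ) {F : Finset ℕ} (hF : F ⊆ W) :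
    monoW k W F ∈ srIdealW k W Γ ↔ F ∉ Γ.faces := by
  have h := monoW_mem_span_iff (k := k) (W := W) (fun S => S ⊆ W ∧ S ∉ Γ.faces) F
  simp only [and_assoc] at h
  refine h.trans ⟨?_, fun hF' => ⟨F, hF, hF', fun x hx _ => hx⟩⟩
  rintro ⟨S, hSW, hS, hSF⟩ hF'
  exact hS (Γ.down_closed hF' fun x hx => hSF x hx (hSW hx))

theorem mem_srIdealW_iff (Γ : SComplex ℕ) (p : MvPolynomial {x // x ∈ W} k) :
    p ∈ srIdealW k W Γ ↔ ∀ m ∈ p.support, ∃ G ⊆ W, G ∉ Γ.faces ∧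
      ∀ w : {x // x ∈ W}, w.1 ∈ G → m w ≠ 0 := by
  have h : {p | ∃ F : Finset ℕ, F ⊆ W ∧ F ∉ Γ.faces ∧ p = monoW k W F} =
      (fun e => monomial e (1 : k)) '' {e | ∃ F : Finset ℕ, F ⊆ W ∧ F ∉ Γ.faces ∧
        e = ∑ i ∈ F.subtype (· ∈ W), Finsupp.single i 1} := by
    have hmono (F : Finset ℕ) : monoW k W F =
        monomial (∑ i ∈ F.subtype (· ∈ W), Finsupp.single i 1) 1 := by
      rw [monomial_sum_one]
      rfl
    ext q
    constructor
    · rintro ⟨F, hFW, hF, rfl⟩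
      exact ⟨_, ⟨F, hFW, hF, rfl⟩, (hmono F).symm⟩
    · rintro ⟨_, ⟨F, hFW, hF, rfl⟩, rfl⟩
      exact ⟨F, hFW, hF, (hmono F).symm⟩
  rw [srIdealW, h, mem_ideal_span_monomial_image]
  refine forall₂_congr fun m _ => ?_
  have hle (F : Finset ℕ) : ∑ i ∈ F.subtype (· ∈ W), Finsupp.single i 1 ≤ m ↔
      ∀ w : {x // x ∈ W}, w.1 ∈ F → m w ≠ 0 := by
    refine forall_congr' fun w => ?_
    by_cases hw : w.1 ∈ F <;>
      simp [Finsupp.finsetSum_apply, Finsupp.single_apply, hw, Nat.one_le_iff_ne_zero]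
  constructor
  · rintro ⟨_, ⟨F, hFW, hF, rfl⟩, he⟩
    exact ⟨F, hFW, hF, (hle F).1 he⟩
  · rintro ⟨F, hFW, hF, he⟩
    exact ⟨_, ⟨F, hFW, hF, rfl⟩, (hle F).2 he⟩

theorem monoW_mem_lexIdealW_iff (n d : ℕ) (A B F : Finset ℕ) :
    monoW k W F ∈ lexIdealW k W n d A B ↔
      ∃ S ∈ lexSegment n d A B, ∀ x ∈ S, x ∈ W → x ∈ F :=
  monoW_mem_span_iff _ F

theorem ringKrullDim_srRingW_le (Γ : SComplex ℕ) (m : ℕ)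
    (h : ∀ F ∈ Γ.faces, F ⊆ W → F.card ≤ m) : ringKrullDim (srRingW k W Γ) ≤ m := by
  classical
  refine ringKrullDim_quotient_le_of_card _ m fun p hp hIp => ?_
  let F : Finset ℕ := (Finset.univ.filter fun w : {x // x ∈ W} => X w ∉ p).map
    (Function.Embedding.subtype _)
  have hFW : F ⊆ W := by
    intro x hx
    obtain ⟨w, -, rfl⟩ := Finset.mem_map.1 hx
    exact w.2
  have hF : F ∈ Γ.faces := by
    by_contra hF
    have h1 := hIp ((monoW_mem_srIdealW_iff (k := k) Γ hFW).2 hF)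
    obtain ⟨w, hw, hwp⟩ := hp.prod_mem_iff.1 h1
    have : X w ∉ p := by simpa [F] using hw
    exact this hwp
  refine le_trans (le_of_eq ?_) (h F hF hFW)
  rw [Finset.card_map, Nat.card_eq_fintype_card, Fintype.card_subtype]
  rfl

theorem card_le_ringKrullDim_srRingW (Γ : SComplex ℕ) {F : Finset ℕ} (hF : F ∈ Γ.faces)
    (hFW : F ⊆ W) : (F.card : WithBot ℕ∞) ≤ ringKrullDim (srRingW k W Γ) := by
  have hcard : ringKrullDim (MvPolynomial {x // x ∈ F} k) = F.card := by
    rw [ringKrullDim_mvPolynomial_field]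
    simp
  rw [← hcard]
  let φ : MvPolynomial {x // x ∈ W} k →ₐ[k] MvPolynomial {x // x ∈ F} k :=
    aeval fun w => if h : w.1 ∈ F then X ⟨w.1, h⟩ else 0
  have hker : ∀ a ∈ srIdealW k W Γ, φ.toRingHom a = 0 := by
    change srIdealW k W Γ ≤ RingHom.ker φ.toRingHom
    refine Ideal.span_le.2 ?_
    rintro _ ⟨G, hGW, hG, rfl⟩
    obtain ⟨x, hxG, hxF⟩ := Finset.not_subset.1 fun h => hG (Γ.down_closed hF h)
    change φ _ = 0
    rw [monoW, map_prod]
    exact Finset.prod_eq_zero (i := ⟨x, hGW hxG⟩) (by simpa using hxG) (by simp [φ, hxF])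
  refine ringKrullDim_le_of_surjective (Ideal.Quotient.lift _ φ.toRingHom hker)
    (Ideal.Quotient.lift_surjective_of_surjective _ hker ?_)
  intro p
  refine ⟨rename (fun w : {x // x ∈ F} => (⟨w.1, hFW w.2⟩ : {x // x ∈ W})) p, ?_⟩
  change φ _ = p
  rw [aeval_rename]
  have : ((fun w : {x // x ∈ W} => if h : w.1 ∈ F then X (R := k) (⟨w.1, h⟩ : {x // x ∈ F})
      else 0) ∘ fun w : {x // x ∈ F} => (⟨w.1, hFW w.2⟩ : {x // x ∈ W})) = X := by
    funext w
    simp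
  rw [this, aeval_X_left_apply]

theorem srIrrelevantW_ne_top (Γ : SComplex ℕ) (h0 : ∅ ∈ Γ.faces) : srIrrelevantW k W Γ ≠ ⊤ := by
  intro h
  have hX : Ideal.span (Set.range (X : {x // x ∈ W} → MvPolynomial {x // x ∈ W} k)) ≤
      RingHom.ker (constantCoeff (R := k)) := by
    refine Ideal.span_le.2 ?_
    rintro _ ⟨w, rfl⟩
    simp [RingHom.mem_ker]
  have hI : srIdealW k W Γ ≤ RingHom.ker (constantCoeff (R := k)) := by
    refine Ideal.span_le.2 ?_
    rintro _ ⟨G, hGW, hG, rfl⟩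
    obtain ⟨x, hx⟩ : G.Nonempty := by
      rw [Finset.nonempty_iff_ne_empty]
      rintro rfl
      exact hG h0
    change constantCoeff _ = 0
    rw [monoW, map_prod]
    exact Finset.prod_eq_zero (i := ⟨x, hGW hx⟩) (by simpa using hx) (by simp)
  have h1 : (1 : srRingW k W Γ) ∈ srIrrelevantW k W Γ := h ▸ Submodule.mem_top
  obtain ⟨y, hy, hy1⟩ := (Ideal.mem_map_iff_of_surjective _ Ideal.Quotient.mk_surjective).1 h1
  rw [← map_one (Ideal.Quotient.mk _), Ideal.Quotient.eq] at hy1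
  have h2 := hI hy1
  have h3 := hX hy
  rw [RingHom.mem_ker] at h2 h3
  simp [h3] at h2

theorem isCMW_of_regularMod {Γ : SComplex ℕ} (h0 : ∅ ∈ Γ.faces)
    (rs : List (MvPolynomial {x // x ∈ W} k))
    (hrs : ∀ p ∈ rs, p ∈ Ideal.span (Set.range X)) (hreg : RegularMod rs (srIdealW k W Γ))
    (hdim : ringKrullDim (srRingW k W Γ) = (rs.length : WithBot ℕ∞)) : IsCMW k W Γ := by
  have hmem : ∀ p ∈ rs.map (Ideal.Quotient.mk (srIdealW k W Γ)), p ∈ srIrrelevantW k W Γ := by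
    intro p hp
    obtain ⟨q, hq, rfl⟩ := List.mem_map.1 hp
    exact Ideal.mem_map_of_mem _ (hrs q hq)
  refine ⟨rs.map (Ideal.Quotient.mk _), hmem,
    ⟨(RegularMod.iff_isWeaklyRegular_map_mk rs _).1 hreg, fun h => ?_⟩, by simpa using hdim⟩
  refine srIrrelevantW_ne_top (k := k) (W := W) Γ h0 (top_le_iff.1 ?_)
  rw [h, smul_eq_mul, Ideal.mul_top]
  exact Ideal.span_le.2 hmem

/-- A complex whose faces are the sets avoiding `U` with no two elements of the same color is
Cohen–Macaulay. -/
theorem isCMW_of_coloring {C : Type*} (f : ℕ → C) (U : Set ℕ) (Γ : SComplex ℕ)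
    (hΓ : ∀ G ⊆ W, G ∈ Γ.faces ↔ (∀ x ∈ G, x ∉ U) ∧ Set.InjOn f G) : IsCMW k W Γ := by
  classical
  let f' : {x // x ∈ W} → C := fun w => f w.1
  let U' : Set {x // x ∈ W} := {w | w.1 ∈ U}
  have hI : srIdealW k W Γ = colorIdeal k f' U' := by
    apply le_antisymm
    · refine Ideal.span_le.2 ?_
      rintro _ ⟨G, hGW, hG, rfl⟩
      rw [hΓ G hGW, not_and_or] at hG
      rcases hG with hG | hG
      · push Not at hG
        obtain ⟨x, hx, hxU⟩ := hG
        have hdvd : (X ⟨x, hGW hx⟩ : MvPolynomial {x // x ∈ W} k) ∣ monoW k W G :=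
          Finset.dvd_prod_of_mem X (by simpa using hx)
        exact Ideal.mem_of_dvd _ hdvd (X_mem_colorIdeal hxU)
      · rw [Set.InjOn] at hG
        push Not at hG
        obtain ⟨a, ha, b, hb, hab, hne⟩ := hG
        have hne' : (⟨a, hGW ha⟩ : {x // x ∈ W}) ≠ ⟨b, hGW hb⟩ := by simpa using hne
        have hdvd : (X ⟨a, hGW ha⟩ * X ⟨b, hGW hb⟩ : MvPolynomial {x // x ∈ W} k) ∣
            monoW k W G := by
          rw [← Finset.prod_pair hne']
          refine Finset.prod_dvd_prod_of_subset _ _ _ ?_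
          intro w hw
          rcases Finset.mem_insert.1 hw with rfl | hw
          · simpa using ha
          · rw [Finset.mem_singleton.1 hw]
            simpa using hb
        exact Ideal.mem_of_dvd _ hdvd (X_mul_X_mem_colorIdeal U' hne' hab)
    · intro p hp
      rw [mem_colorIdeal] at hp
      rw [mem_srIdealW_iff]
      intro m hm
      rcases hp m hm with ⟨w, hw, hmw⟩ | ⟨a, b, hab, hfab, ha, hb⟩
      · have hwW : {w.1} ⊆ W := by simp
        refine ⟨{w.1}, hwW, fun h => ?_, fun w' hw' => ?_⟩
        · exact ((hΓ _ hwW).1 h).1 w.1 (by simp) hw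
        · rwa [Subtype.ext (Finset.mem_singleton.1 hw')]
      · have habW : {a.1, b.1} ⊆ W := by simp [Finset.insert_subset_iff]
        refine ⟨{a.1, b.1}, habW, fun h => ?_, fun w' hw' => ?_⟩
        · exact hab (Subtype.ext (((hΓ _ habW).1 h).2 (by simp) (by simp) hfab))
        · rcases Finset.mem_insert.1 hw' with h | h
          · rwa [Subtype.ext h]
          · rwa [Subtype.ext (Finset.mem_singleton.1 h)]
  let V : Finset ℕ := W.filter (· ∉ U)
  let l := (V.image f).toList
  have hl : ∀ c, c ∈ l ↔ ∃ x ∈ W, x ∉ U ∧ f x = c := by simp [l, V, and_assoc]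
  have hreg : RegularMod (l.map (colorSum k f')) (srIdealW k W Γ) := by
    rw [hI]
    refine regularMod_colorIdeal l (Finset.nodup_toList _) U' fun c hc => ?_
    obtain ⟨x, hxW, hxU, hx⟩ := (hl c).1 hc
    exact ⟨⟨x, hxW⟩, hxU, hx⟩
  have h0 : ∅ ∈ Γ.faces := (hΓ ∅ (by simp)).2 (by simp)
  refine isCMW_of_regularMod h0 _ (fun p hp => ?_) hreg ?_
  · obtain ⟨c, -, rfl⟩ := List.mem_map.1 hp
    exact Ideal.sum_mem _ fun w _ => Ideal.subset_span ⟨w, rfl⟩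
  · rw [List.length_map, Finset.length_toList]
    apply le_antisymm
    · refine ringKrullDim_srRingW_le Γ _ fun F hF hFW => ?_
      obtain ⟨hFU, hinj⟩ := (hΓ F hFW).1 hF
      rw [← Finset.card_image_of_injOn hinj]
      refine Finset.card_le_card (Finset.image_subset_image fun x hx => ?_)
      exact Finset.mem_filter.2 ⟨hFW hx, hFU x hx⟩
    · obtain ⟨G, hGV, hG, hinj⟩ : ∃ G ⊆ V, G.image f = V.image f ∧ Set.InjOn f G := by
        obtain ⟨G, hGV, hbij⟩ := (Set.surjOn_image f V).exists_bijOn_subset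
        lift G to Finset ℕ using V.finite_toSet.subset hGV
        refine ⟨G, by exact_mod_cast hGV, ?_, hbij.injOn⟩
        have := hbij.image_eq
        exact_mod_cast this
      have hGW : G ⊆ W := hGV.trans (Finset.filter_subset _ _)
      have hGΓ : G ∈ Γ.faces :=
        (hΓ G hGW).2 ⟨fun x hx => (Finset.mem_filter.1 (hGV hx)).2, hinj⟩
      rw [← hG, Finset.card_image_of_injOn hinj]
      exact card_le_ringKrullDim_srRingW Γ hGΓ hGW

/-- If `Γ` is a cone with apex `x` over a Cohen–Macaulay complex `Γ'`, then `Γ` is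
Cohen–Macaulay. -/
theorem IsCMW.of_cone {Γ Γ' : SComplex ℕ} {x : ℕ} (hx : x ∈ W) (h0 : ∅ ∈ Γ'.faces)
    (hΓ' : ∀ G ∈ Γ'.faces, G ⊆ W ∧ x ∉ G) (hΓ : ∀ G, G ∈ Γ.faces ↔ G.erase x ∈ Γ'.faces)
    (h : IsCMW k W Γ') : IsCMW k W Γ := by
  obtain ⟨rs', hrs', hreg', hdim'⟩ := h
  obtain ⟨rs, rfl⟩ : ∃ rs : List (Ideal.span (Set.range
      (X : {x // x ∈ W} → MvPolynomial {x // x ∈ W} k))),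
      rs.map (fun p => Ideal.Quotient.mk (srIdealW k W Γ') p.1) = rs' := by
    rw [← Set.mem_range, Set.range_list_map]
    intro p hp
    obtain ⟨q, hq, rfl⟩ := (Ideal.mem_map_iff_of_surjective _ Ideal.Quotient.mk_surjective).1
      (hrs' p hp)
    exact ⟨⟨q, hq⟩, rfl⟩
  have hreg : RegularMod (rs.map (·.1)) (srIdealW k W Γ') := by
    rw [RegularMod.iff_isWeaklyRegular_map_mk, List.map_map]
    exact hreg'.toIsWeaklyRegular
  have hsup : srIdealW k W Γ ⊔ Ideal.span {X ⟨x, hx⟩} = srIdealW k W Γ' := by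
    apply le_antisymm
    · refine sup_le (Ideal.span_le.2 ?_) ?_
      · rintro _ ⟨G, hGW, hG, rfl⟩
        refine (monoW_mem_srIdealW_iff Γ' hGW).2 fun hG' => hG ?_
        rw [hΓ, Finset.erase_eq_of_notMem (hΓ' G hG').2]
        exact hG'
      · rw [Ideal.span_singleton_le_iff_mem]
        have h1 : monoW k W {x} ∈ srIdealW k W Γ' :=
          (monoW_mem_srIdealW_iff Γ' (by simpa using hx)).2 fun h => (hΓ' _ h).2 (by simp)
        have h2 : monoW k W {x} = X ⟨x, hx⟩ := by
          rw [monoW]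
          have : Finset.subtype (· ∈ W) {x} = {⟨x, hx⟩} := by
            ext w
            simp [Subtype.ext_iff]
          rw [this, Finset.prod_singleton]
        rwa [← h2]
    · refine Ideal.span_le.2 ?_
      rintro _ ⟨G, hGW, hG, rfl⟩
      by_cases hxG : x ∈ G
      · refine Ideal.mem_sup_right (Ideal.mem_span_singleton.2 ?_)
        exact Finset.dvd_prod_of_mem _ (by simpa using hxG)
      · refine Ideal.mem_sup_left ((monoW_mem_srIdealW_iff Γ hGW).2 fun hG' => hG ?_)
        rwa [hΓ, Finset.erase_eq_of_notMem hxG] at hG'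
  have hreg_x : ∀ a, X ⟨x, hx⟩ * a ∈ srIdealW k W Γ → a ∈ srIdealW k W Γ := by
    intro a ha
    rw [mem_srIdealW_iff] at ha ⊢
    intro m hm
    obtain ⟨G, hGW, hG, hGm⟩ := ha (Finsupp.single ⟨x, hx⟩ 1 + m) (by
      rw [support_X_mul]
      exact Finset.mem_map_of_mem _ hm)
    refine ⟨G.erase x, (G.erase_subset x).trans hGW, fun h => hG ?_, fun w hw => ?_⟩
    · rwa [hΓ, Finset.erase_idem, ← hΓ] at h
    · obtain ⟨hwx, hwG⟩ := Finset.mem_erase.1 hw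
      have h1 : (⟨x, hx⟩ : {x // x ∈ W}) ≠ w := fun h => hwx (by rw [← h])
      simpa [Finsupp.single_apply, h1] using hGm w hwG
  refine isCMW_of_regularMod ((hΓ _).2 (by simpa using h0)) (X ⟨x, hx⟩ :: rs.map (·.1)) ?_
    ⟨hreg_x, by rwa [hsup]⟩ ?_
  · intro p hp
    rcases List.mem_cons.1 hp with rfl | hp
    · exact Ideal.subset_span ⟨_, rfl⟩
    · obtain ⟨q, -, rfl⟩ := List.mem_map.1 hp
      exact q.2
  · have hle (G : Finset ℕ) (hG : G ∈ Γ'.faces) : G.card ≤ rs.length := by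
      have := card_le_ringKrullDim_srRingW (k := k) Γ' hG (hΓ' G hG).1
      rw [hdim', List.length_map] at this
      exact_mod_cast this
    obtain ⟨G, hG, hGcard⟩ : ∃ G ∈ Γ'.faces, rs.length ≤ G.card := by
      by_contra! hlt
      have hpos := hlt ∅ h0
      have := ringKrullDim_srRingW_le (k := k) (W := W) Γ' (rs.length - 1)
        fun G hG _ => Nat.le_sub_one_of_lt (hlt G hG)
      rw [hdim', List.length_map] at this
      have : rs.length ≤ rs.length - 1 := by exact_mod_cast this
      lia
    apply le_antisymm
    · refine ringKrullDim_srRingW_le Γ _ fun F hF hFW => ?_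
      have := hle _ ((hΓ F).1 hF)
      have := Finset.pred_card_le_card_erase (s := F) (a := x)
      simp only [List.length_cons, List.length_map]
      lia
    · have hxG := (hΓ' G hG).2
      have hcone : insert x G ∈ Γ.faces := by rwa [hΓ, Finset.erase_insert hxG]
      refine le_trans ?_ (card_le_ringKrullDim_srRingW Γ hcone
        (Finset.insert_subset hx (hΓ' G hG).1))
      rw [Finset.card_insert_of_notMem hxG, List.length_cons, List.length_map]
      exact_mod_cast Nat.succ_le_succ hGcard

end StanleyReisner

section LexEdges

/-- For `a < b`, the condition that `{a, b}` lies in the lexsegment `L({i, j}, {r, s})`. -/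
def LexEdge (i j r s a b : ℕ) : Prop :=
  (i < a ∨ i = a ∧ j ≤ b) ∧ (a < r ∨ a = r ∧ b ≤ s)

theorem lexGT_pair_iff {a b c d : ℕ} (hab : a < b) (hcd : c < d) :
    lexGT {a, b} {c, d} ↔ a < c ∨ a = c ∧ b < d := by
  constructor
  · rintro ⟨m, hm, hm', h⟩
    simp only [Finset.mem_insert, Finset.mem_singleton, not_or] at hm hm' h
    have ha := h a
    have hc := h c
    have hd := h d
    lia
  · rintro (h | ⟨rfl, h⟩)
    · refine ⟨a, by simp, ?_, fun x hx => ?_⟩ <;>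
        simp only [Finset.mem_insert, Finset.mem_singleton] <;> lia
    · refine ⟨b, by simp, ?_, fun x hx => ?_⟩ <;>
        simp only [Finset.mem_insert, Finset.mem_singleton] <;> lia

theorem lexGE_pair_iff {a b c d : ℕ} (hab : a < b) (hcd : c < d) :
    lexGE {a, b} {c, d} ↔ a < c ∨ a = c ∧ b ≤ d := by
  rw [lexGE, lexGT_pair_iff hab hcd]
  constructor
  · rintro (h | h)
    · have ha : a ∈ ({c, d} : Finset ℕ) := h ▸ by simp
      have hb : b ∈ ({c, d} : Finset ℕ) := h ▸ by simp
      simp only [Finset.mem_insert, Finset.mem_singleton] at ha hb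
      lia
    · lia
  · intro h
    by_cases hac : a = c ∧ b = d
    · exact Or.inl (by rw [hac.1, hac.2])
    · exact Or.inr (by lia)

theorem mem_lexSegment_two_iff {n i j r s : ℕ} (hij : i < j) (hrs : r < s) (S : Finset ℕ) :
    S ∈ lexSegment n 2 {i, j} {r, s} ↔
      ∃ a b, a < b ∧ 1 ≤ a ∧ b ≤ n ∧ LexEdge i j r s a b ∧ S = {a, b} := by
  constructor
  · rintro ⟨hS, hcard, h₁, h₂⟩
    obtain ⟨a, b, hab, rfl⟩ : ∃ a b, a < b ∧ S = {a, b} := by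
      obtain ⟨a, b, hne, rfl⟩ := Finset.card_eq_two.1 hcard
      rcases lt_or_gt_of_ne hne with h | h
      · exact ⟨a, b, h, rfl⟩
      · exact ⟨b, a, h, Finset.pair_comm a b⟩
    rw [lexGE_pair_iff hij hab] at h₁
    rw [lexGE_pair_iff hab hrs] at h₂
    exact ⟨a, b, hab, (Finset.mem_Icc.1 (hS (by simp))).1, (Finset.mem_Icc.1 (hS (by simp))).2,
      ⟨h₁, h₂⟩, rfl⟩
  · rintro ⟨a, b, hab, ha, hb, ⟨h₁, h₂⟩, rfl⟩
    refine ⟨?_, Finset.card_pair hab.ne, (lexGE_pair_iff hij hab).2 h₁,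
      (lexGE_pair_iff hab hrs).2 h₂⟩
    intro x hx
    simp only [Finset.mem_insert, Finset.mem_singleton, Finset.mem_Icc] at hx ⊢
    lia

/-- The faces of the complex of `(L({i, j}, {r, s}))` are the sets containing no edge of the
lexsegment. -/
theorem mem_faces_iff_of_srIdealW_eq (k : Type*) [Field k] {n c i j r s : ℕ} (hij : i < j)
    (hrs : r < s) (hc : 1 ≤ c) (hci : c ≤ i) (Δ : SComplex ℕ)
    (hΔsub : ∀ F ∈ Δ.faces, F ⊆ Finset.Icc c n)
    (hΔ : srIdealW k (Finset.Icc c n) Δ = lexIdealW k (Finset.Icc c n) n 2 {i, j} {r, s})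
    (F : Finset ℕ) :
    F ∈ Δ.faces ↔ F ⊆ Finset.Icc c n ∧ ∀ a ∈ F, ∀ b ∈ F, a < b → ¬ LexEdge i j r s a b := by
  by_cases hF : F ⊆ Finset.Icc c n
  swap
  · exact ⟨fun h => absurd (hΔsub F h) hF, fun h => absurd h.1 hF⟩
  have h := monoW_mem_srIdealW_iff (k := k) Δ hF
  rw [hΔ, monoW_mem_lexIdealW_iff] at h
  rw [← not_iff_not, ← h, and_iff_right hF]
  push Not
  simp only [mem_lexSegment_two_iff hij hrs]
  constructor
  · rintro ⟨_, ⟨a, b, hab, ha, hb, hE, rfl⟩, hS⟩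
    have hE' := hE
    rw [LexEdge] at hE'
    exact ⟨a, hS a (by simp) (Finset.mem_Icc.2 (by lia)), b,
      hS b (by simp) (Finset.mem_Icc.2 (by lia)), hab, hE⟩
  · rintro ⟨a, ha, b, hb, hab, hE⟩
    have ha' := Finset.mem_Icc.1 (hF ha)
    have hb' := Finset.mem_Icc.1 (hF hb)
    refine ⟨_, ⟨a, b, hab, by lia, by lia, hE, rfl⟩, fun x hx _ => ?_⟩
    rcases Finset.mem_insert.1 hx with rfl | hx
    · exact ha
    · rwa [Finset.mem_singleton.1 hx]

variable {n c i j r s : ℕ} {Δ : SComplex ℕ}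

theorem isFacet_of_forall_edge
    (hF : ∀ F, F ∈ Δ.faces ↔
      F ⊆ Finset.Icc c n ∧ ∀ a ∈ F, ∀ b ∈ F, a < b → ¬ LexEdge i j r s a b)
    {F : Finset ℕ} (hFsub : ∀ x ∈ F, c ≤ x ∧ x ≤ n)
    (hind : ∀ a ∈ F, ∀ b ∈ F, a < b → ¬ LexEdge i j r s a b)
    (hmax : ∀ x, c ≤ x → x ≤ n → x ∉ F →
      ∃ y ∈ F, x < y ∧ LexEdge i j r s x y ∨ y < x ∧ LexEdge i j r s y x) : Δ.IsFacet F := by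
  refine ⟨(hF F).2 ⟨fun x hx => Finset.mem_Icc.2 (hFsub x hx), hind⟩, fun G hG hFG => ?_⟩
  refine hFG.antisymm fun x hx => ?_
  by_contra hxF
  obtain ⟨hGsub, hGind⟩ := (hF G).1 hG
  obtain ⟨h₁, h₂⟩ := Finset.mem_Icc.1 (hGsub hx)
  obtain ⟨y, hy, ⟨h, hE⟩ | ⟨h, hE⟩⟩ := hmax x h₁ h₂ hxF
  · exact hGind x hx y (hFG hy) h hE
  · exact hGind y (hFG hy) x hx h hE

theorem exists_isFacet_superset (hsub : ∀ F ∈ Δ.faces, F ⊆ Finset.Icc c n) {F : Finset ℕ}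
    (hF : F ∈ Δ.faces) : ∃ G, Δ.IsFacet G ∧ F ⊆ G := by
  have hfin : Δ.faces.Finite :=
    (Finset.Icc c n).powerset.finite_toSet.subset fun G hG => Finset.mem_coe.2 (Finset.mem_powerset.2 (hsub G hG))
  obtain ⟨G, hFG, hG⟩ := hfin.exists_le_maximal hF
  exact ⟨G, ⟨hG.prop, fun H hH hGH => hGH.antisymm (hG.le_of_ge hH hGH)⟩, hFG⟩

theorem card_le_two_of_isFacet (hsub : ∀ F ∈ Δ.faces, F ⊆ Finset.Icc c n) (hpure : Δ.Pure)
    {A : Finset ℕ} (hA : Δ.IsFacet A) (hcard : A.card ≤ 2) : ∀ F ∈ Δ.faces, F.card ≤ 2 := by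
  intro F hF
  obtain ⟨G, hG, hFG⟩ := exists_isFacet_superset hsub hF
  have := Finset.card_le_card hFG
  have := hpure hA hG
  lia

/-- A pure complex of a quadratic lexsegment starting at the first variable either has dimension
at most one, or comes from the complete intersection `(x_i x_n, x_{i+1} x_{i+2})`. -/
theorem card_le_two_or_of_pure (hij : i < j) (hrs : r < s) (hjn : j ≤ n) (hsn : s ≤ n)
    (huv : i < r ∨ i = r ∧ j < s)
    (hF : ∀ F, F ∈ Δ.faces ↔
      F ⊆ Finset.Icc i n ∧ ∀ a ∈ F, ∀ b ∈ F, a < b → ¬ LexEdge i j r s a b)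
    (hpure : Δ.Pure) :
    (∀ F ∈ Δ.faces, F.card ≤ 2) ∨ (r = i + 1 ∧ s = i + 2 ∧ j = n ∧ i + 3 ≤ n) := by
  have hsub : ∀ F ∈ Δ.faces, F ⊆ Finset.Icc i n := fun F h => ((hF F).1 h).1
  rcases huv with hir | ⟨rfl, hjs⟩
  · by_cases hr : i + 1 < r
    · left
      by_cases hj : j = i + 1
      · refine card_le_two_of_isFacet hsub hpure (A := {i + 1})
          (isFacet_of_forall_edge hF ?_ ?_ ?_) (by simp)
        · simp only [Finset.mem_singleton]; lia
        · simp only [Finset.mem_singleton]; lia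
        · simp only [Finset.mem_singleton, LexEdge, exists_eq_left]; lia
      · refine card_le_two_of_isFacet hsub hpure (A := {i, i + 1})
          (isFacet_of_forall_edge hF ?_ ?_ ?_) Finset.card_le_two
        · simp only [Finset.mem_insert, Finset.mem_singleton]; lia
        · simp only [Finset.mem_insert, Finset.mem_singleton, LexEdge]; lia
        · simp only [Finset.mem_insert, Finset.mem_singleton, LexEdge]
          intro x h₁ h₂ h₃
          exact ⟨i + 1, by lia, by lia⟩
    · obtain rfl : r = i + 1 := by lia
      by_cases hj : j = i + 1
      · left
        refine card_le_two_of_isFacet hsub hpure (A := {i})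
          (isFacet_of_forall_edge hF ?_ ?_ ?_) (by simp)
        · simp only [Finset.mem_singleton]; lia
        · simp only [Finset.mem_singleton]; lia
        · simp only [Finset.mem_singleton, LexEdge, exists_eq_left]; lia
      by_cases hjs : j ≤ s + 1
      · left
        refine card_le_two_of_isFacet hsub hpure (A := {i, i + 1})
          (isFacet_of_forall_edge hF ?_ ?_ ?_) Finset.card_le_two
        · simp only [Finset.mem_insert, Finset.mem_singleton]; lia
        · simp only [Finset.mem_insert, Finset.mem_singleton, LexEdge]; lia
        · simp only [Finset.mem_insert, Finset.mem_singleton, LexEdge]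
          intro x h₁ h₂ h₃
          by_cases hxs : x ≤ s
          · exact ⟨i + 1, by lia, by lia⟩
          · exact ⟨i, by lia, by lia⟩
      · right
        have hA : Δ.IsFacet (insert i (insert (i + 1) (Finset.Icc (s + 1) (j - 1)))) := by
          refine isFacet_of_forall_edge hF ?_ ?_ ?_
          · simp only [Finset.mem_insert, Finset.mem_Icc]; lia
          · simp only [Finset.mem_insert, Finset.mem_Icc, LexEdge]; lia
          · simp only [Finset.mem_insert, Finset.mem_Icc, LexEdge]
            intro x h₁ h₂ h₃
            by_cases hxs : x ≤ s
            · exact ⟨i + 1, by lia, by lia⟩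
            · exact ⟨i, by lia, by lia⟩
        have hB : Δ.IsFacet (insert i (Finset.Icc (i + 2) (j - 1))) := by
          refine isFacet_of_forall_edge hF ?_ ?_ ?_
          · simp only [Finset.mem_insert, Finset.mem_Icc]; lia
          · simp only [Finset.mem_insert, Finset.mem_Icc, LexEdge]; lia
          · simp only [Finset.mem_insert, Finset.mem_Icc, LexEdge]
            intro x h₁ h₂ h₃
            by_cases hx : x = i + 1
            · exact ⟨i + 2, by lia, by lia⟩
            · exact ⟨i, by lia, by lia⟩
        have hC : Δ.IsFacet (Finset.Icc (i + 2) n) := by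
          refine isFacet_of_forall_edge hF ?_ ?_ ?_
          · simp only [Finset.mem_Icc]; lia
          · simp only [Finset.mem_Icc, LexEdge]; lia
          · simp only [Finset.mem_Icc, LexEdge]
            intro x h₁ h₂ h₃
            by_cases hx : x = i + 1
            · exact ⟨i + 2, by lia, by lia⟩
            · exact ⟨n, by lia, by lia⟩
        have h₁ := hpure hA hB
        have h₂ := hpure hB hC
        rw [Finset.card_insert_of_notMem (by simp [Finset.mem_Icc]; lia),
          Finset.card_insert_of_notMem (by simp [Finset.mem_Icc]; lia),
          Finset.card_insert_of_notMem (by simp [Finset.mem_Icc]), Nat.card_Icc,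
          Nat.card_Icc] at h₁
        rw [Finset.card_insert_of_notMem (by simp [Finset.mem_Icc]), Nat.card_Icc,
          Nat.card_Icc] at h₂
        lia
  · exfalso
    have hA : Δ.IsFacet (Finset.Icc i n \ Finset.Icc j s) := by
      refine isFacet_of_forall_edge hF ?_ ?_ ?_
      · simp only [Finset.mem_sdiff, Finset.mem_Icc]; lia
      · simp only [Finset.mem_sdiff, Finset.mem_Icc, LexEdge]; lia
      · simp only [Finset.mem_sdiff, Finset.mem_Icc, LexEdge]
        intro x h₁ h₂ h₃
        exact ⟨i, by lia, by lia⟩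
    have hB : Δ.IsFacet (Finset.Icc (i + 1) n) := by
      refine isFacet_of_forall_edge hF ?_ ?_ ?_
      · simp only [Finset.mem_Icc]; lia
      · simp only [Finset.mem_Icc, LexEdge]; lia
      · simp only [Finset.mem_Icc, LexEdge]
        intro x h₁ h₂ h₃
        exact ⟨j, by lia, by lia⟩
    have h := hpure hA hB
    rw [Finset.card_sdiff_of_subset (Finset.Icc_subset_Icc hij.le hsn), Nat.card_Icc,
      Nat.card_Icc, Nat.card_Icc] at h
    lia

/-- If, among the vertices outside `F` that span a face with `F`, the edges are the pairs of
the same color, then the link of `F` is Cohen–Macaulay. -/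
theorem isCMW_link_of_coloring {C : Type*} (k : Type*) [Field k] (f : ℕ → C)
    (hF : ∀ F, F ∈ Δ.faces ↔
      F ⊆ Finset.Icc c n ∧ ∀ a ∈ F, ∀ b ∈ F, a < b → ¬ LexEdge i j r s a b)
    {F : Finset ℕ} (hFΔ : F ∈ Δ.faces)
    (hf : ∀ a b, a < b → a ∉ F → b ∉ F → insert a F ∈ Δ.faces → insert b F ∈ Δ.faces →
      (LexEdge i j r s a b ↔ f a = f b)) :
    IsCMW k (Finset.Icc c n) (Δ.link F) := by
  refine isCMW_of_coloring f {x | x ∈ F ∨ insert x F ∉ Δ.faces} _ fun G hG => ?_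
  have hins {x : ℕ} (hx : x ∉ {x | x ∈ F ∨ insert x F ∉ Δ.faces}) :
      x ∉ F ∧ insert x F ∈ Δ.faces := by simpa using hx
  constructor
  · rintro ⟨hGΔ, hdis, hGF⟩
    have hout : ∀ x ∈ G, x ∉ F ∧ insert x F ∈ Δ.faces := fun x hx =>
      ⟨Finset.disjoint_left.1 hdis hx, Δ.down_closed hGF
        (Finset.insert_subset (Finset.mem_union_left _ hx) Finset.subset_union_right)⟩
    have hne : ∀ a ∈ G, ∀ b ∈ G, a < b → f a ≠ f b := fun a ha b hb hab h =>
      ((hF G).1 hGΔ).2 a ha b hb hab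
        ((hf a b hab (hout a ha).1 (hout b hb).1 (hout a ha).2 (hout b hb).2).2 h)
    refine ⟨fun x hx => by simpa using hout x hx, fun a ha b hb hab => ?_⟩
    rcases lt_trichotomy a b with h | h | h
    · exact absurd hab (hne a ha b hb h)
    · exact h
    · exact absurd hab.symm (hne b hb a ha h)
  · rintro ⟨hGU, hinj⟩
    have hGF : G ∪ F ∈ Δ.faces := by
      refine (hF _).2 ⟨Finset.union_subset hG ((hF F).1 hFΔ).1, fun a ha b hb hab hE => ?_⟩
      rcases Finset.mem_union.1 ha with ha | ha <;> rcases Finset.mem_union.1 hb with hb | hb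
      · have ha' := hins (hGU a ha)
        have hb' := hins (hGU b hb)
        exact hab.ne (hinj ha hb ((hf a b hab ha'.1 hb'.1 ha'.2 hb'.2).1 hE))
      · exact ((hF _).1 (hins (hGU a ha)).2).2 a (by simp) b (by simp [hb]) hab hE
      · exact ((hF _).1 (hins (hGU b hb)).2).2 a (by simp [ha]) b (by simp) hab hE
      · exact ((hF _).1 hFΔ).2 a ha b hb hab hE
    exact ⟨Δ.down_closed hGF Finset.subset_union_left,
      Finset.disjoint_left.2 fun x hx => (hins (hGU x hx)).1, hGF⟩

section Restriction

variable {Δ₂ : SComplex ℕ}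
  (hF : ∀ F, F ∈ Δ.faces ↔
    F ⊆ Finset.Icc 1 n ∧ ∀ a ∈ F, ∀ b ∈ F, a < b → ¬ LexEdge i j r s a b)
  (hF₂ : ∀ F, F ∈ Δ₂.faces ↔
    F ⊆ Finset.Icc i n ∧ ∀ a ∈ F, ∀ b ∈ F, a < b → ¬ LexEdge i j r s a b)
include hF hF₂

theorem mem_faces_iff_filter_mem (F : Finset ℕ) :
    F ∈ Δ.faces ↔ F ⊆ Finset.Icc 1 n ∧ F.filter (i ≤ ·) ∈ Δ₂.faces := by
  rw [hF, hF₂]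
  refine and_congr_right fun hFn => ⟨fun h => ⟨fun x hx => ?_, fun a ha b hb => ?_⟩,
    fun h a ha b hb hab hE => ?_⟩
  · rw [Finset.mem_filter] at hx
    exact Finset.mem_Icc.2 ⟨hx.2, (Finset.mem_Icc.1 (hFn hx.1)).2⟩
  · exact h a (Finset.mem_filter.1 ha).1 b (Finset.mem_filter.1 hb).1
  · have hai : i ≤ a := by rw [LexEdge] at hE; lia
    exact h.2 a (Finset.mem_filter.2 ⟨ha, hai⟩) b (Finset.mem_filter.2 ⟨hb, by lia⟩) hab hE

variable (hi : 1 ≤ i) (hin : i ≤ n)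
include hi

omit hF in
theorem filter_Icc_union {G : Finset ℕ} (hG : G ∈ Δ₂.faces) :
    (Finset.Icc 1 (i - 1) ∪ G).filter (i ≤ ·) = G := by
  ext x
  have : x ∈ G → i ≤ x := fun hx => (Finset.mem_Icc.1 (((hF₂ G).1 hG).1 hx)).1
  simp only [Finset.mem_filter, Finset.mem_union, Finset.mem_Icc]
  lia

omit hF₂ in
theorem subset_Icc_union_filter {F : Finset ℕ} (hFΔ : F ∈ Δ.faces) :
    F ⊆ Finset.Icc 1 (i - 1) ∪ F.filter (i ≤ ·) := by
  intro x hx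
  have := Finset.mem_Icc.1 (((hF F).1 hFΔ).1 hx)
  simp only [Finset.mem_filter, Finset.mem_union, Finset.mem_Icc, hx]
  lia

include hin

theorem Icc_union_mem_faces {G : Finset ℕ} (hG : G ∈ Δ₂.faces) :
    Finset.Icc 1 (i - 1) ∪ G ∈ Δ.faces := by
  rw [mem_faces_iff_filter_mem hF hF₂, filter_Icc_union hF₂ hi hG]
  exact ⟨Finset.union_subset (Finset.Icc_subset_Icc le_rfl (by lia))
    (((hF₂ G).1 hG).1.trans (Finset.Icc_subset_Icc hi le_rfl)), hG⟩

theorem isFacet_Icc_union {G : Finset ℕ} (hG : Δ₂.IsFacet G) :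
    Δ.IsFacet (Finset.Icc 1 (i - 1) ∪ G) := by
  refine ⟨Icc_union_mem_faces hF hF₂ hi hin hG.1, fun H hH hGH => hGH.antisymm ?_⟩
  have h := hG.2 _ ((mem_faces_iff_filter_mem hF hF₂ H).1 hH).2 (by
    rw [← filter_Icc_union hF₂ hi hG.1]
    exact Finset.filter_subset_filter _ hGH)
  rw [h]
  exact subset_Icc_union_filter hF hi hH

theorem exists_eq_Icc_union_of_isFacet {F : Finset ℕ} (hFΔ : Δ.IsFacet F) :
    ∃ G, Δ₂.IsFacet G ∧ F = Finset.Icc 1 (i - 1) ∪ G := by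
  have hG := ((mem_faces_iff_filter_mem hF hF₂ F).1 hFΔ.1).2
  have hsub := subset_Icc_union_filter hF hi hFΔ.1
  refine ⟨F.filter (i ≤ ·), ⟨hG, fun G' hG' hGG' => ?_⟩,
    hFΔ.2 _ (Icc_union_mem_faces hF hF₂ hi hin hG) hsub⟩
  have h := hFΔ.2 _ (Icc_union_mem_faces hF hF₂ hi hin hG')
    (hsub.trans (Finset.union_subset_union_right hGG'))
  rw [← filter_Icc_union hF₂ hi hG', ← h]

theorem pure_iff_pure_restriction : Δ.Pure ↔ Δ₂.Pure := by
  have hcard (G : Finset ℕ) (hG : Δ₂.IsFacet G) :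
      (Finset.Icc 1 (i - 1) ∪ G).card = i - 1 + G.card := by
    rw [Finset.card_union_of_disjoint, Nat.card_Icc, Nat.add_sub_cancel]
    refine Finset.disjoint_left.2 fun x hx hxG => ?_
    have := Finset.mem_Icc.1 (((hF₂ G).1 hG.1).1 hxG)
    have := Finset.mem_Icc.1 hx
    lia
  constructor
  · intro h G H hG hH
    have := h (isFacet_Icc_union hF hF₂ hi hin hG) (isFacet_Icc_union hF hF₂ hi hin hH)
    rw [hcard G hG, hcard H hH] at this
    lia
  · intro h F F' hFΔ hFΔ'
    obtain ⟨G, hG, rfl⟩ := exists_eq_Icc_union_of_isFacet hF hF₂ hi hin hFΔ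
    obtain ⟨H, hH, rfl⟩ := exists_eq_Icc_union_of_isFacet hF hF₂ hi hin hFΔ'
    rw [hcard G hG, hcard H hH, h hG hH]

omit hi hin in
/-- If the restriction of `Δ` to `[i, n]` is pure, the link of a face of `Δ` meeting `[i, n]`
is Cohen–Macaulay. -/
theorem isCMW_link_of_pure (k : Type*) [Field k] (hij : i < j) (hrs : r < s) (hjn : j ≤ n)
    (hsn : s ≤ n) (huv : i < r ∨ i = r ∧ j < s) (hpure : Δ₂.Pure) {F : Finset ℕ}
    (hFΔ : F ∈ Δ.faces) {x : ℕ} (hx : x ∈ F) (hix : i ≤ x) :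
    IsCMW k (Finset.Icc 1 n) (Δ.link F) := by
  rcases card_le_two_or_of_pure hij hrs hjn hsn huv hF₂ hpure with h2 | ⟨rfl, rfl, rfl, hi3⟩
  · refine isCMW_link_of_coloring k (fun w => min w i) hF hFΔ
      fun a b hab ha hb haF hbF => ⟨fun hE => ?_, fun hmin => ?_⟩
    · rw [LexEdge] at hE
      lia
    · by_contra hE
      have hai : i ≤ a := by lia
      have haF' := (hF _).1 haF
      have hbF' := (hF _).1 hbF
      have hxa : x ≠ a := fun h => ha (h ▸ hx)
      have hxb : x ≠ b := fun h => hb (h ▸ hx)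
      have hT : {x, a, b} ∈ Δ₂.faces := by
        refine (hF₂ _).2 ⟨?_, ?_⟩
        · have h₁ := Finset.mem_Icc.1 (haF'.1 (Finset.mem_insert_self a F))
          have h₂ := Finset.mem_Icc.1 (hbF'.1 (Finset.mem_insert_self b F))
          have h₃ := Finset.mem_Icc.1 (haF'.1 (Finset.mem_insert_of_mem hx))
          intro y hy
          simp only [Finset.mem_insert, Finset.mem_singleton, Finset.mem_Icc] at hy ⊢
          lia
        · have h₁ := haF'.2 a (by simp) x (by simp [hx])
          have h₂ := haF'.2 x (by simp [hx]) a (by simp)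
          have h₃ := hbF'.2 b (by simp) x (by simp [hx])
          have h₄ := hbF'.2 x (by simp [hx]) b (by simp)
          intro y hy z hz hyz
          simp only [Finset.mem_insert, Finset.mem_singleton] at hy hz
          rcases hy with rfl | rfl | rfl <;> rcases hz with rfl | rfl | rfl <;>
            lia
      have := h2 _ hT
      rw [Finset.card_eq_three.2 ⟨x, a, b, hxa, hxb, hab.ne, rfl⟩] at this
      lia
  · refine isCMW_link_of_coloring k
      (fun w => if w = j then i else if w = i + 2 then i + 1 else w) hF hFΔ
      fun a b hab ha hb haF hbF => ?_
    have hbn := Finset.mem_Icc.1 (((hF _).1 hbF).1 (Finset.mem_insert_self b F))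
    rw [LexEdge]
    split_ifs <;> lia

end Restriction

end LexEdges

theorem SComplex.dimSucc_simplexOn {V : Type*} [DecidableEq V] (W : Finset V) :
    (SComplex.simplexOn W).dimSucc = W.card := by
  have hW : W ∈ (SComplex.simplexOn W).faces := Finset.Subset.refl W
  apply le_antisymm
  · refine csSup_le ⟨_, W, hW, rfl⟩ ?_
    rintro _ ⟨F, hF, rfl⟩
    exact Finset.card_le_card hF
  · refine le_csSup ⟨W.card, ?_⟩ ⟨W, hW, rfl⟩
    rintro _ ⟨F, hF, rfl⟩
    exact Finset.card_le_card hF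

/-- Let `u = xᵢxⱼ > v = xᵣxₛ`, `Δ` the associated lexsegment
complex, `Δ₁` the full simplex on `{1, …, i-1}`, `Δ₂` the complex of the
lexsegment ideal in `k[xᵢ, …, xₙ]`, and `t ≥ 2`; assume `Δ` is not `CM_{t-1}`
over `k`. Then `Δ` is `CM_t` over `k` iff `Δ₁` has dimension `t - 2`
(i.e. `i = t`) and `Δ₂` is pure. -/
theorem lexsegment_CMt_iff_pure (k : Type*) [Field k] (n i j r s : ℕ) (hij : i < j) (hrs : r < s)
    (hUsub : ({i, j} : Finset ℕ) ⊆ Finset.Icc 1 n)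
    (hVsub : ({r, s} : Finset ℕ) ⊆ Finset.Icc 1 n)
    (huv : lexGT {i, j} {r, s})
    (Δ : SComplex ℕ) (hΔsub : ∀ F ∈ Δ.faces, F ⊆ Finset.Icc 1 n)
    (hΔ : srIdealW k (Finset.Icc 1 n) Δ = lexIdealW k (Finset.Icc 1 n) n 2 {i, j} {r, s})
    (Δ₂ : SComplex ℕ) (hΔ₂sub : ∀ F ∈ Δ₂.faces, F ⊆ Finset.Icc i n)
    (hΔ₂ : srIdealW k (Finset.Icc i n) Δ₂ = lexIdealW k (Finset.Icc i n) n 2 {i, j} {r, s})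
    (t : ℕ) (ht : 2 ≤ t)
    (hN : ¬ IsCMtW k (Finset.Icc 1 n) (t - 1) Δ) :
    IsCMtW k (Finset.Icc 1 n) t Δ ↔
      ((SComplex.simplexOn (Finset.Icc 1 (i - 1)) : SComplex ℕ).dimSucc = t - 1 ∧
        Δ₂.Pure) := by
  have hi : 1 ≤ i := (Finset.mem_Icc.1 (hUsub (by simp))).1
  have hjn : j ≤ n := (Finset.mem_Icc.1 (hUsub (by simp))).2
  have hsn : s ≤ n := (Finset.mem_Icc.1 (hVsub (by simp))).2
  rw [lexGT_pair_iff hij hrs] at huv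
  have hF := mem_faces_iff_of_srIdealW_eq k hij hrs le_rfl hi Δ hΔsub hΔ
  have hF₂ := mem_faces_iff_of_srIdealW_eq k hij hrs hi le_rfl Δ₂ hΔ₂sub hΔ₂
  have hpure := pure_iff_pure_restriction hF hF₂ hi (by lia)
  rw [SComplex.dimSucc_simplexOn, Nat.card_Icc]
  constructor
  · rintro ⟨hΔpure, hCM⟩
    have hΔ₂pure := hpure.1 hΔpure
    refine ⟨?_, hΔ₂pure⟩
    by_contra hne
    refine hN ⟨hΔpure, fun F hFΔ hcard => ?_⟩
    by_cases hx : ∃ x ∈ F, i ≤ x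
    · obtain ⟨x, hx, hix⟩ := hx
      exact isCMW_link_of_pure hF hF₂ k hij hrs hjn hsn huv hΔ₂pure hFΔ hx hix
    push Not at hx
    by_cases hcard' : t ≤ F.card
    · exact hCM F hFΔ hcard'
    have hFi : F ⊆ Finset.Icc 1 (i - 1) := fun x hxF => by
      have := Finset.mem_Icc.1 (hΔsub F hFΔ hxF)
      have := hx x hxF
      exact Finset.mem_Icc.2 (by lia)
    have hlt : F.card < (Finset.Icc 1 (i - 1)).card := by
      have := Finset.card_le_card hFi
      rw [Nat.card_Icc] at this ⊢
      lia
    obtain ⟨x, hx', hxF⟩ := Finset.exists_mem_notMem_of_card_lt_card hlt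
    rw [Finset.mem_Icc] at hx'
    have hxn : x ∈ Finset.Icc 1 n := Finset.mem_Icc.2 (by lia)
    have hins (G : Finset ℕ) : insert x G ∈ Δ.faces ↔ G ∈ Δ.faces := by
      rw [mem_faces_iff_filter_mem hF hF₂, mem_faces_iff_filter_mem hF hF₂ G,
        Finset.filter_insert, if_neg (by lia), Finset.insert_subset_iff, and_iff_right hxn]
    have hxFΔ := (hins F).2 hFΔ
    refine IsCMW.of_cone hxn (Γ' := Δ.link (insert x F)) ?_ ?_ ?_
      (hCM _ hxFΔ (by rw [Finset.card_insert_of_notMem hxF]; lia))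
    · exact ⟨Δ.down_closed hFΔ (Finset.empty_subset F), Finset.disjoint_empty_left _,
        by rwa [Finset.empty_union]⟩
    · rintro G ⟨hG, hdis, -⟩
      exact ⟨hΔsub G hG, fun h => Finset.disjoint_left.1 hdis h (Finset.mem_insert_self x F)⟩
    · intro G
      have hie : insert x (G.erase x) = insert x G := by
        ext y
        simp only [Finset.mem_insert, Finset.mem_erase]
        tauto
      have herase : G.erase x ∈ Δ.faces ↔ G ∈ Δ.faces := by
        rw [← hins, hie, hins]
      have hunion : G.erase x ∪ insert x F ∈ Δ.faces ↔ G ∪ F ∈ Δ.faces := by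
        rw [Finset.union_insert, ← Finset.insert_union, hie,
          Finset.insert_union, hins]
      have hdisj : Disjoint (G.erase x) (insert x F) ↔ Disjoint G F := by
        simp only [Finset.disjoint_left, Finset.mem_erase, Finset.mem_insert, not_or]
        exact ⟨fun h a ha haF => (h ⟨fun hax => hxF (hax ▸ haF), ha⟩).2 haF,
          fun h a ha => ⟨ha.1, h ha.2⟩⟩
      exact and_congr herase.symm (and_congr hdisj.symm hunion.symm)
  · rintro ⟨hti, hΔ₂pure⟩
    refine ⟨hpure.2 hΔ₂pure, fun F hFΔ hcard => ?_⟩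
    obtain ⟨x, hx, hix⟩ : ∃ x ∈ F, i ≤ x := by
      by_contra! hlt
      have hFi : F ⊆ Finset.Icc 1 (i - 1) := fun x hxF => by
        have := Finset.mem_Icc.1 (hΔsub F hFΔ hxF)
        have := hlt x hxF
        exact Finset.mem_Icc.2 (by lia)
      have := Finset.card_le_card hFi
      rw [Nat.card_Icc] at this
      lia
    exact isCMW_link_of_pure hF hF₂ k hij hrs hjn hsn huv hΔ₂pure hFΔ hx hix
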